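/- arXiv:2604.09343 — 7 statements merged into one kernel-verified Lean document; each statement's English description precedes it below -/
import Mathlib

section
/- Let f0 be a continuous, strictly positive probability density on [0,1] with CDF F0(θ) = ∫_0^θ f0(x)dx. Fix v* ∈ (0,1), let w* = (∫_{v*}^1 x f0(x)dx)/(1 − F0(v*)) and w0 = (∫_0^{v*} x f0(x)dx)/F0(v*). Fix q* > 0, set t* = w* q*, and let b ≥ w* − v*. Define u_I(w) = 0 for w ∈ [0, w*) and u_I(w) = (w+b)q* − t* for w ∈ [w*, 1]; set λ = b q*/(w* − v*) and define p*(w) = 0 for w ∈ [0, v*] and p*(w) = λ(w − v*) for w ∈ [v*, 1]. Let G be the two-point probability distribution placing mass F0(v*) at w0 and mass 1 − F0(v*) at w*. Then: (i) p*(w) ≥ u_I(w) for every w ∈ [0,1]; (ii) p* is convex on [0,1]; (iii) p*(w0) = u_I(w0) = 0 and p*(w*) = u_I(w*) = bq*; and (iv) F0(v*)·p*(w0) + (1 − F0(v*))·p*(w*) = ∫_0^1 p*(θ) f0(θ)dθ. -/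
open MeasureTheory Set

/-- The mean of a positive continuous density on `[a, c]` lies strictly between `a` and `c`. -/
theorem mul_integral_lt_integral_id_mul_lt {f : ℝ → ℝ} {a c : ℝ} (hac : a < c)
    (hf : ContinuousOn f (Icc a c)) (hpos : ∀ x ∈ Icc a c, 0 < f x) :
    a * (∫ x in a..c, f x) < (∫ x in a..c, x * f x) ∧
      (∫ x in a..c, x * f x) < c * (∫ x in a..c, f x) := by
  have hi : IntervalIntegrable f volume a c := hf.intervalIntegrable_of_Icc hac.le
  have hxi : IntervalIntegrable (fun x => x * f x) volume a c :=
    (continuousOn_id.mul hf).intervalIntegrable_of_Icc hac.le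
  rw [← intervalIntegral.integral_const_mul, ← intervalIntegral.integral_const_mul]
  constructor
  · rw [← sub_pos, ← intervalIntegral.integral_sub hxi (hi.const_mul a)]
    refine intervalIntegral.intervalIntegral_pos_of_pos_on (hxi.sub (hi.const_mul a)) ?_ hac
    intro x hx
    rw [← sub_mul]
    exact mul_pos (sub_pos.2 hx.1) (hpos x (Ioo_subset_Icc_self hx))
  · rw [← sub_pos, ← intervalIntegral.integral_sub (hi.const_mul c) hxi]
    refine intervalIntegral.intervalIntegral_pos_of_pos_on ((hi.const_mul c).sub hxi) ?_ hac
    intro x hx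
    rw [← sub_mul]
    exact mul_pos (sub_pos.2 hx.2) (hpos x (Ioo_subset_Icc_self hx))

/-- A function that vanishes up to `v` and has constant nonnegative slope beyond `v` is convex. -/
theorem convexOn_Icc_of_hinge {p : ℝ → ℝ} {v l : ℝ} (hl : 0 ≤ l)
    (h₁ : ∀ w, 0 ≤ w → w ≤ v → p w = 0)
    (h₂ : ∀ w, v ≤ w → w ≤ 1 → p w = l * (w - v)) :
    ConvexOn ℝ (Icc (0 : ℝ) 1) p := by
  have haff : ConvexOn ℝ (Icc (0 : ℝ) 1) (fun w => l * (w - v)) := by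
    refine ⟨convex_Icc 0 1, fun x _ y _ s t _ _ hst => le_of_eq ?_⟩
    simp only [smul_eq_mul]
    linear_combination (l * v) * hst
  refine ((convexOn_const 0 (convex_Icc 0 1)).sup haff).congr fun w hw => ?_
  rcases le_total w v with h | h
  · rw [h₁ w hw.1 h]
    exact max_eq_left (mul_nonpos_of_nonneg_of_nonpos hl (sub_nonpos.2 h))
  · rw [h₂ w h hw.2]
    exact max_eq_right (mul_nonneg hl (sub_nonneg.2 h))

/-- Proposition 3, sufficiency direction: when the intermediary's bias `b` is at least
`w* − v*`, the function `p*` is a dual price function certifying that the two-atom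
pooling distribution solves the intermediary's persuasion problem given the single-item
menu `(q*, t*)` with `t* = w* q*`. -/
theorem stmt0
    (f0 : ℝ → ℝ)
    (hf0cont : ContinuousOn f0 (Icc 0 1))
    (hf0pos : ∀ x ∈ Icc (0:ℝ) 1, 0 < f0 x)
    (hf0prob : ∫ x in (0:ℝ)..1, f0 x = 1)
    (F0 : ℝ → ℝ) (hF0 : ∀ θ, F0 θ = ∫ x in (0:ℝ)..θ, f0 x)
    (vstar : ℝ) (hv : vstar ∈ Ioo (0:ℝ) 1)
    (wstar w0 : ℝ)
    (hwstar : wstar = (∫ x in vstar..1, x * f0 x) / (1 - F0 vstar))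
    (hw0 : w0 = (∫ x in (0:ℝ)..vstar, x * f0 x) / F0 vstar)
    (qstar : ℝ) (hq : 0 < qstar)
    (tstar : ℝ) (htstar : tstar = wstar * qstar)
    (b : ℝ) (hb : wstar - vstar ≤ b)
    (uI : ℝ → ℝ)
    (huI1 : ∀ w, 0 ≤ w → w < wstar → uI w = 0)
    (huI2 : ∀ w, wstar ≤ w → w ≤ 1 → uI w = (w + b) * qstar - tstar)
    (lam : ℝ) (hlam : lam = b * qstar / (wstar - vstar))
    (pstar : ℝ → ℝ)
    (hp1 : ∀ w, 0 ≤ w → w ≤ vstar → pstar w = 0)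
    (hp2 : ∀ w, vstar ≤ w → w ≤ 1 → pstar w = lam * (w - vstar)) :
    (∀ w ∈ Icc (0:ℝ) 1, uI w ≤ pstar w) ∧
    ConvexOn ℝ (Icc (0:ℝ) 1) pstar ∧
    (pstar w0 = 0 ∧ uI w0 = 0 ∧ pstar wstar = b * qstar ∧ uI wstar = b * qstar) ∧
    F0 vstar * pstar w0 + (1 - F0 vstar) * pstar wstar
      = ∫ θ in (0:ℝ)..1, pstar θ * f0 θ := by
  obtain ⟨hv0, hv1⟩ := hv
  have hsub₁ : Icc 0 vstar ⊆ Icc (0 : ℝ) 1 := Icc_subset_Icc_right hv1.le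
  have hsub₂ : Icc vstar 1 ⊆ Icc (0 : ℝ) 1 := Icc_subset_Icc_left hv0.le
  have hcont₁ := hf0cont.mono hsub₁
  have hcont₂ := hf0cont.mono hsub₂
  have hi₁ : IntervalIntegrable f0 volume 0 vstar := hcont₁.intervalIntegrable_of_Icc hv0.le
  have hi₂ : IntervalIntegrable f0 volume vstar 1 := hcont₂.intervalIntegrable_of_Icc hv1.le
  have hF : 1 - F0 vstar = ∫ x in vstar..1, f0 x := by
    rw [hF0]
    linarith [intervalIntegral.integral_add_adjacent_intervals hi₁ hi₂]
  have hFpos : 0 < F0 vstar := by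
    rw [hF0]
    exact intervalIntegral.intervalIntegral_pos_of_pos_on hi₁
      (fun x hx => hf0pos x (hsub₁ (Ioo_subset_Icc_self hx))) hv0
  have hFlt : 0 < 1 - F0 vstar := by
    rw [hF]
    exact intervalIntegral.intervalIntegral_pos_of_pos_on hi₂
      (fun x hx => hf0pos x (hsub₂ (Ioo_subset_Icc_self hx))) hv1
  have hmean₁ := mul_integral_lt_integral_id_mul_lt hv0 hcont₁ fun x hx => hf0pos x (hsub₁ hx)
  have hmean₂ := mul_integral_lt_integral_id_mul_lt hv1 hcont₂ fun x hx => hf0pos x (hsub₂ hx)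
  rw [← hF0, zero_mul] at hmean₁
  rw [← hF] at hmean₂
  have hw0_pos : 0 < w0 := hw0 ▸ div_pos hmean₁.1 hFpos
  have hw0_lt : w0 < vstar := hw0 ▸ (div_lt_iff₀ hFpos).2 hmean₁.2
  have hwstar_gt : vstar < wstar := hwstar ▸ (lt_div_iff₀ hFlt).2 hmean₂.1
  have hwstar_lt : wstar < 1 := hwstar ▸ (div_lt_iff₀ hFlt).2 hmean₂.2
  have hd : 0 < wstar - vstar := sub_pos.2 hwstar_gt
  have hlam_mul : lam * (wstar - vstar) = b * qstar := by
    rw [hlam, div_mul_cancel₀ _ hd.ne']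
  have hq_le : qstar ≤ lam := by
    rw [hlam, le_div_iff₀ hd, mul_comm]
    exact mul_le_mul_of_nonneg_right hb hq.le
  have hlam_pos : 0 < lam := hq.trans_le hq_le
  have hp0 : pstar w0 = 0 := hp1 w0 hw0_pos.le hw0_lt.le
  have hpw : pstar wstar = b * qstar := by rw [hp2 wstar hwstar_gt.le hwstar_lt.le, hlam_mul]
  refine ⟨fun w hw => ?_, convexOn_Icc_of_hinge hlam_pos.le hp1 hp2,
    ⟨hp0, huI1 w0 hw0_pos.le (hw0_lt.trans hwstar_gt), hpw, ?_⟩, ?_⟩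
  · rcases lt_or_ge w wstar with h | h
    · rw [huI1 w hw.1 h]
      rcases le_total w vstar with h' | h'
      · rw [hp1 w hw.1 h']
      · rw [hp2 w h' hw.2]
        exact mul_nonneg hlam_pos.le (sub_nonneg.2 h')
    · rw [huI2 w h hw.2, hp2 w (hwstar_gt.le.trans h) hw.2, htstar]
      linarith [mul_le_mul_of_nonneg_right hq_le (sub_nonneg.2 h)]
  · rw [huI2 wstar le_rfl hwstar_lt.le, htstar]
    ring
  · have heq₁ : EqOn (fun _ => 0) (fun θ => pstar θ * f0 θ) (uIcc 0 vstar) := fun θ hθ => by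
      rw [uIcc_of_le hv0.le] at hθ
      simp [hp1 θ hθ.1 hθ.2]
    have heq₂ : EqOn (fun θ => lam * (θ * f0 θ) - lam * vstar * f0 θ)
        (fun θ => pstar θ * f0 θ) (uIcc vstar 1) := fun θ hθ => by
      rw [uIcc_of_le hv1.le] at hθ
      simp only [hp2 θ hθ.1 hθ.2]
      ring
    have hxi : IntervalIntegrable (fun x => lam * (x * f0 x)) volume vstar 1 :=
      ((continuousOn_id.mul hcont₂).intervalIntegrable_of_Icc hv1.le).const_mul lam
    have hli := hi₂.const_mul (lam * vstar)
    rw [← intervalIntegral.integral_add_adjacent_intervals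
        (intervalIntegrable_const.congr (heq₁.mono uIoc_subset_uIcc))
        ((hxi.sub hli).congr (heq₂.mono uIoc_subset_uIcc)),
      ← intervalIntegral.integral_congr heq₁, ← intervalIntegral.integral_congr heq₂,
      intervalIntegral.integral_sub hxi hli, intervalIntegral.integral_const_mul,
      intervalIntegral.integral_const_mul, ← hF, intervalIntegral.integral_zero,
      hp0, hpw, ← hlam_mul]
    rw [eq_div_iff hFlt.ne'] at hwstar
    rw [← hwstar]
    ring
end

section
/- Let f0 be a continuous, strictly positive probability density on [0,1] with CDF F0(θ) = ∫_0^θ f0(x)dx. Fix v* ∈ (0,1), let w* = (∫_{v*}^1 x f0(x)dx)/(1 − F0(v*)) and w0 = (∫_0^{v*} x f0(x)dx)/F0(v*). Fix q* > 0, set t* = w* q*, and suppose 0 ≤ b < w* − v*. Define u_I(w) = 0 for w ∈ [0, w*) and u_I(w) = (w+b)q* − t* for w ∈ [w*, 1]. Then there exists NO convex function p : [0,1] → ℝ satisfying all of: (i) p(w) ≥ u_I(w) for every w ∈ [0,1]; (ii) p(w0) = u_I(w0) = 0 and p(w*) = u_I(w*) = bq*; and (iii) F0(v*)·p(w0) +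 (1 − F0(v*))·p(w*) = ∫_0^1 p(θ) f0(θ)dθ. -/
open MeasureTheory Set

/-- A convex function on `[0, 1]` lying above the line of slope `q` through `(x₀, f x₀)` to the right
of an interior point `x₀` has a supporting line at `x₀` of slope at least `q`. -/
theorem ConvexOn.exists_supporting_slope_ge {f : ℝ → ℝ} {x₀ q : ℝ}
    (hf : ConvexOn ℝ (Icc 0 1) f) (hx₀ : x₀ ∈ Ioo (0 : ℝ) 1)
    (hright : ∀ y, x₀ < y → y ≤ 1 → f x₀ + q * (y - x₀) ≤ f y) :
    ∃ s, q ≤ s ∧ ∀ x ∈ Icc (0 : ℝ) 1, f x₀ + s * (x - x₀) ≤ f x := by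
  let A : Set ℝ := insert q ((fun x => (f x₀ - f x) / (x₀ - x)) '' Ico 0 x₀)
  let B : Set ℝ := (fun y => (f y - f x₀) / (y - x₀)) '' Ioc x₀ 1
  have hAB : ∀ a ∈ A, ∀ c ∈ B, a ≤ c := by
    rintro a ha c ⟨y, hy, rfl⟩
    have hy0 : 0 < y - x₀ := sub_pos.2 hy.1
    rcases ha with rfl | ⟨x, hx, rfl⟩
    · have := hright y hy.1 hy.2
      change a ≤ (f y - f x₀) / (y - x₀)
      rw [le_div_iff₀ hy0]
      linarith
    · exact hf.slope_mono_adjacent ⟨hx.1, hx.2.le.trans hx₀.2.le⟩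
        ⟨hx₀.1.le.trans hy.1.le, hy.2⟩ hx.2 hy.1
  obtain ⟨s, hsA, hsB⟩ := exists_between_of_forall_le (s := A) (t := B) ⟨q, mem_insert _ _⟩
    ⟨_, mem_image_of_mem _ ⟨hx₀.2, le_rfl⟩⟩ hAB
  refine ⟨s, hsA (mem_insert _ _), fun x hx => ?_⟩
  rcases lt_trichotomy x x₀ with h | rfl | h
  · have h1 : (f x₀ - f x) / (x₀ - x) ≤ s :=
      hsA (mem_insert_of_mem _ (mem_image_of_mem _ ⟨hx.1, h⟩))
    rw [div_le_iff₀ (sub_pos.2 h)] at h1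
    linarith
  · simp
  · have h1 : s ≤ (f x - f x₀) / (x - x₀) := hsB (mem_image_of_mem _ ⟨h, hx.2⟩)
    rw [le_div_iff₀ (sub_pos.2 h)] at h1
    linarith

/-- A nonnegative convex function times a continuous function is integrable on `[0, 1]`. -/
theorem ConvexOn.intervalIntegrable_mul_of_nonneg {f g : ℝ → ℝ} (hf : ConvexOn ℝ (Icc 0 1) f)
    (hf0 : ∀ x ∈ Icc (0 : ℝ) 1, 0 ≤ f x) (hg : ContinuousOn g (Icc 0 1)) :
    IntervalIntegrable (fun x => f x * g x) volume 0 1 := by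
  have hfi : IntervalIntegrable f volume 0 1 := by
    rw [intervalIntegrable_iff_integrableOn_Ioo_of_le zero_le_one]
    have hc : ContinuousOn f (Ioo 0 1) := by
      simpa only [interior_Icc] using hf.continuousOn_interior
    refine IntegrableOn.of_bound measure_Ioo_lt_top
      (hc.aestronglyMeasurable measurableSet_Ioo) (max (f 0) (f 1)) ?_
    filter_upwards [ae_restrict_mem measurableSet_Ioo] with x hx
    have hx' := Ioo_subset_Icc_self hx
    rw [Real.norm_of_nonneg (hf0 x hx')]
    exact hf.le_max_of_mem_Icc (left_mem_Icc.2 zero_le_one) (right_mem_Icc.2 zero_le_one) hx'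
  exact hfi.mul_continuousOn (by rwa [uIcc_of_le zero_le_one])

/-- Proposition 3, necessity direction: when the intermediary's bias `b` is strictly below
`w* − v*`, no dual price function exists for the two-atom pooling distribution induced
by the single-item menu `(q*, t*)` with `t* = w* q*`. -/
theorem stmt1
    (f0 : ℝ → ℝ)
    (hf0cont : ContinuousOn f0 (Icc 0 1))
    (hf0pos : ∀ x ∈ Icc (0:ℝ) 1, 0 < f0 x)
    (hf0prob : ∫ x in (0:ℝ)..1, f0 x = 1)
    (F0 : ℝ → ℝ) (hF0 : ∀ θ, F0 θ = ∫ x in (0:ℝ)..θ, f0 x)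
    (vstar : ℝ) (hv : vstar ∈ Ioo (0:ℝ) 1)
    (wstar w0 : ℝ)
    (hwstar : wstar = (∫ x in vstar..1, x * f0 x) / (1 - F0 vstar))
    (hw0 : w0 = (∫ x in (0:ℝ)..vstar, x * f0 x) / F0 vstar)
    (qstar : ℝ) (hq : 0 < qstar)
    (tstar : ℝ) (htstar : tstar = wstar * qstar)
    (b : ℝ) (hb0 : 0 ≤ b) (hb : b < wstar - vstar)
    (uI : ℝ → ℝ)
    (huI1 : ∀ w, 0 ≤ w → w < wstar → uI w = 0)
    (huI2 : ∀ w, wstar ≤ w → w ≤ 1 → uI w = (w + b) * qstar - tstar) :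
    ¬ ∃ p : ℝ → ℝ, ConvexOn ℝ (Icc (0:ℝ) 1) p ∧
        (∀ w ∈ Icc (0:ℝ) 1, uI w ≤ p w) ∧
        p w0 = uI w0 ∧ p w0 = 0 ∧ p wstar = uI wstar ∧ p wstar = b * qstar ∧
        F0 vstar * p w0 + (1 - F0 vstar) * p wstar
          = ∫ θ in (0:ℝ)..1, p θ * f0 θ := by
  rintro ⟨p, hconv, hp, -, hpw0, -, hpws, heq⟩
  obtain ⟨hv0, hv1⟩ := hv
  have hsubl : Icc (0 : ℝ) vstar ⊆ Icc 0 1 := Icc_subset_Icc_right hv1.le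
  have hsubr : Icc vstar 1 ⊆ Icc (0 : ℝ) 1 := Icc_subset_Icc_left hv0.le
  have hfr : ContinuousOn f0 (Icc vstar 1) := hf0cont.mono hsubr
  have hil : IntervalIntegrable f0 volume 0 vstar :=
    (hf0cont.mono hsubl).intervalIntegrable_of_Icc hv0.le
  have hir : IntervalIntegrable f0 volume vstar 1 := hfr.intervalIntegrable_of_Icc hv1.le
  have hixr : IntervalIntegrable (fun x => x * f0 x) volume vstar 1 :=
    (continuousOn_id.mul hfr).intervalIntegrable_of_Icc hv1.le
  have hm : 1 - F0 vstar = ∫ x in vstar..1, f0 x := by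
    have h := intervalIntegral.integral_add_adjacent_intervals hil hir
    rw [hF0]
    linarith
  have hmpos : 0 < ∫ x in vstar..1, f0 x :=
    intervalIntegral.intervalIntegral_pos_of_pos_on hir
      (fun x hx => hf0pos x (hsubr (Ioo_subset_Icc_self hx))) hv1
  rw [hm] at hwstar heq
  have hmean : ∫ x in vstar..1, x * f0 x = wstar * ∫ x in vstar..1, f0 x := by
    rw [hwstar, div_mul_cancel₀ _ hmpos.ne']
  have hws1 : wstar < 1 := by
    have : ∫ x in vstar..1, x * f0 x < ∫ x in vstar..1, f0 x := by
      refine intervalIntegral.integral_lt_integral_of_continuousOn_of_le_of_exists_lt hv1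
        (continuousOn_id.mul hfr) hfr (fun x hx => ?_) ⟨vstar, left_mem_Icc.2 hv1.le, ?_⟩
      · exact mul_le_of_le_one_left (hf0pos x ⟨hv0.le.trans hx.1.le, hx.2⟩).le hx.2
      · exact mul_lt_of_lt_one_left (hf0pos vstar ⟨hv0.le, hv1.le⟩) hv1
    rw [hwstar, div_lt_one hmpos]
    exact this
  have hp0 : ∀ x ∈ Icc (0 : ℝ) 1, 0 ≤ p x := by
    intro x hx
    refine le_trans ?_ (hp x hx)
    rcases lt_or_ge x wstar with h | h
    · rw [huI1 x hx.1 h]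
    · rw [huI2 x h hx.2, htstar]
      nlinarith
  obtain ⟨s, hs, hline⟩ := hconv.exists_supporting_slope_ge (x₀ := wstar) (q := qstar)
    ⟨by linarith, hws1⟩ (fun y hy hy1 => by
      have h := hp y ⟨by linarith, hy1⟩
      rw [huI2 y hy.le hy1, htstar] at h
      rw [hpws]
      linarith)
  rw [hpws] at hline
  have hpi := hconv.intervalIntegrable_mul_of_nonneg hp0 hf0cont
  have hpil : IntervalIntegrable (fun x => p x * f0 x) volume 0 vstar :=
    hpi.mono_set (by rwa [uIcc_of_le hv0.le, uIcc_of_le zero_le_one])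
  have hpir : IntervalIntegrable (fun x => p x * f0 x) volume vstar 1 :=
    hpi.mono_set (by rwa [uIcc_of_le hv1.le, uIcc_of_le zero_le_one])
  have hleft : 0 ≤ ∫ x in (0 : ℝ)..vstar, p x * f0 x :=
    intervalIntegral.integral_nonneg hv0.le fun x hx =>
      mul_nonneg (hp0 x (hsubl hx)) (hf0pos x (hsubl hx)).le
  have hlc : Continuous fun x : ℝ => b * qstar + s * (x - wstar) := by fun_prop
  have hgc : Continuous fun x : ℝ => max (b * qstar + s * (x - wstar)) 0 :=
    hlc.max continuous_const
  have hlt : ∫ x in vstar..1, (b * qstar + s * (x - wstar)) * f0 x <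
      ∫ x in vstar..1, max (b * qstar + s * (x - wstar)) 0 * f0 x := by
    refine intervalIntegral.integral_lt_integral_of_continuousOn_of_le_of_exists_lt hv1
      (hlc.continuousOn.mul hfr) (hgc.continuousOn.mul hfr) (fun x hx => ?_)
      ⟨vstar, left_mem_Icc.2 hv1.le, ?_⟩
    · exact mul_le_mul_of_nonneg_right (le_max_left _ _)
        (hf0pos x ⟨hv0.le.trans hx.1.le, hx.2⟩).le
    · refine mul_lt_mul_of_pos_right (lt_max_of_lt_right ?_) (hf0pos vstar ⟨hv0.le, hv1.le⟩)
      nlinarith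
  have hle : ∫ x in vstar..1, max (b * qstar + s * (x - wstar)) 0 * f0 x ≤
      ∫ x in vstar..1, p x * f0 x :=
    intervalIntegral.integral_mono_on hv1.le
      ((hgc.continuousOn.mul hfr).intervalIntegrable_of_Icc hv1.le) hpir fun x hx =>
        mul_le_mul_of_nonneg_right (max_le (hline x (hsubr hx)) (hp0 x (hsubr hx)))
          (hf0pos x (hsubr hx)).le
  have hlin : ∫ x in vstar..1, (b * qstar + s * (x - wstar)) * f0 x =
      (∫ x in vstar..1, f0 x) * (b * qstar) := by
    have h : ∀ x, (b * qstar + s * (x - wstar)) * f0 x =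
        (b * qstar - s * wstar) * f0 x + s * (x * f0 x) := fun x => by ring
    simp only [h]
    rw [intervalIntegral.integral_add (hir.const_mul _) (hixr.const_mul _),
      intervalIntegral.integral_const_mul, intervalIntegral.integral_const_mul, hmean]
    ring
  rw [hpw0, hpws, ← intervalIntegral.integral_add_adjacent_intervals hpil hpir] at heq
  linarith
end

section
/- Fix b ≥ 1/3. Define Π_b : [0,1] × [0,∞) → ℝ by Π_b(w, q) = (1 − max(w − b, 2w − 1, 0))·(w·q − q²/2). Then Π_b(w, q) ≤ 4/27 for all (w, q) ∈ [0,1] × [0,∞), with equality if and only if (w, q) = (2/3, 2/3). -/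
open Set

/-- High-bias branch of the optimal single-item menu (Section 6.1): for `b ≥ 1/3`, the
profit `Π_b(w, q) = (1 − max(w − b, 2w − 1, 0))(wq − q²/2)` is at most `4/27` on
`[0,1] × [0,∞)`, with equality iff `(w, q) = (2/3, 2/3)`. -/
theorem stmt7 (b : ℝ) (hb : 1 / 3 ≤ b) :
    ∀ w ∈ Icc (0:ℝ) 1, ∀ q : ℝ, 0 ≤ q →
      (1 - max (w - b) (max (2 * w - 1) 0)) * (w * q - q ^ 2 / 2) ≤ 4 / 27 ∧
      ((1 - max (w - b) (max (2 * w - 1) 0)) * (w * q - q ^ 2 / 2) = 4 / 27 ↔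
        w = 2 / 3 ∧ q = 2 / 3) := by
  rintro w ⟨hw0, hw1⟩ q -
  have hM0 : 0 ≤ 1 - max (w - b) (max (2 * w - 1) 0) := by
    have : max (w - b) (max (2 * w - 1) 0) ≤ 1 :=
      max_le (by linarith) (max_le (by linarith) zero_le_one)
    linarith
  have hM1 : 1 - max (w - b) (max (2 * w - 1) 0) ≤ 2 * (1 - w) := by
    have : 2 * w - 1 ≤ max (w - b) (max (2 * w - 1) 0) :=
      (le_max_left _ _).trans (le_max_right _ _)
    linarith
  have hMeq : w = 2 / 3 → 1 - max (w - b) (max (2 * w - 1) 0) = 2 / 3 := by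
    rintro rfl
    rw [max_eq_left (by norm_num : (0 : ℝ) ≤ 2 * (2 / 3) - 1), max_eq_right (by linarith)]
    norm_num
  generalize 1 - max (w - b) (max (2 * w - 1) 0) = M at hM0 hM1 hMeq ⊢
  have gap : 4 / 27 - M * (w * q - q ^ 2 / 2) =
      (w - 2 / 3) ^ 2 * (w + 1 / 3) + (2 * (1 - w) - M) * (w ^ 2 / 2)
        + M * ((w - q) ^ 2 / 2) := by ring
  have h1 : 0 ≤ (w - 2 / 3) ^ 2 * (w + 1 / 3) := by positivity
  have h2 : 0 ≤ (2 * (1 - w) - M) * (w ^ 2 / 2) :=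
    mul_nonneg (by linarith) (by positivity)
  have h3 : 0 ≤ M * ((w - q) ^ 2 / 2) := by positivity
  refine ⟨by linarith, fun h => ?_, ?_⟩
  · have hw : w = 2 / 3 := by
      have h0 : (w - 2 / 3) ^ 2 * (w + 1 / 3) = 0 := by linarith
      have hpos : w + 1 / 3 ≠ 0 := by positivity
      exact sub_eq_zero.mp (pow_eq_zero_iff two_ne_zero |>.mp
        ((mul_eq_zero.mp h0).resolve_right hpos))
    have hM := hMeq hw
    have hsq : (w - q) ^ 2 = 0 := by
      have h0 : M * ((w - q) ^ 2 / 2) = 0 := by linarith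
      rw [hM] at h0
      linarith
    have hwq : w - q = 0 := pow_eq_zero_iff two_ne_zero |>.mp hsq
    exact ⟨hw, by linarith⟩
  · rintro ⟨hw, hq⟩
    rw [hMeq hw, hw, hq]
    norm_num
end

section
/- Fix b with 1/5 ≤ b ≤ 1/3. Define Π_b : [0,1] × [0,∞) → ℝ by Π_b(w, q) = (1 − max(w − b, 2w − 1, 0))·(w·q − q²/2). Then Π_b(w, q) ≤ b(1 − b)² for all (w, q) ∈ [0,1] × [0,∞), with equality if and only if (w, q) = (1 − b, 1 − b). -/
open Set

/-- Away from `w = 1 - b`, the profit at the optimal quality `q = w` is strictly below `b(1 - b)²`. -/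
lemma demand_mul_sq_lt {b w : ℝ} (hb1 : 1 / 5 ≤ b) (hb2 : b ≤ 1 / 3) (hw : 0 ≤ w)
    (hne : w ≠ 1 - b) :
    (1 - max (w - b) (max (2 * w - 1) 0)) * (w ^ 2 / 2) < b * (1 - b) ^ 2 := by
  have hsq : 0 ≤ w ^ 2 / 2 := by positivity
  rcases lt_or_gt_of_ne hne with h | h
  · have hD : 1 - max (w - b) (max (2 * w - 1) 0) ≤ 1 + b - w := by
      linarith [le_max_left (w - b) (max (2 * w - 1) 0)]
    have hfactor : 0 < 2 * b * (1 - b + w) - w ^ 2 := by nlinarith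
    have hgap := mul_pos (sub_pos.2 h) hfactor
    linarith [mul_le_mul_of_nonneg_right hD hsq]
  · have hD : 1 - max (w - b) (max (2 * w - 1) 0) ≤ 2 - 2 * w := by
      linarith [(le_max_left (2 * w - 1) 0).trans (le_max_right (w - b) (max (2 * w - 1) 0))]
    have hfactor : 0 < (1 - b) ^ 2 + (1 - b) * w + w ^ 2 - (1 - b) - w := by nlinarith
    have hgap := mul_pos (sub_pos.2 h) hfactor
    linarith [mul_le_mul_of_nonneg_right hD hsq]

/-- Intermediate-bias branch of the optimal single-item menu (Section 6.1): for
`1/5 ≤ b ≤ 1/3`, the profit `Π_b(w, q) = (1 − max(w − b, 2w − 1, 0))(wq − q²/2)` is at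
most `b(1 − b)²` on `[0,1] × [0,∞)`, with equality iff `(w, q) = (1 − b, 1 − b)`. -/
theorem stmt8 (b : ℝ) (hb1 : 1 / 5 ≤ b) (hb2 : b ≤ 1 / 3) :
    ∀ w ∈ Icc (0:ℝ) 1, ∀ q : ℝ, 0 ≤ q →
      (1 - max (w - b) (max (2 * w - 1) 0)) * (w * q - q ^ 2 / 2) ≤ b * (1 - b) ^ 2 ∧
      ((1 - max (w - b) (max (2 * w - 1) 0)) * (w * q - q ^ 2 / 2) = b * (1 - b) ^ 2 ↔
        w = 1 - b ∧ q = 1 - b) := by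
  intro w hw q _
  have hD : 0 ≤ 1 - max (w - b) (max (2 * w - 1) 0) := by
    have := max_le (show w - b ≤ 1 by linarith [hw.2])
      (max_le (show 2 * w - 1 ≤ 1 by linarith [hw.2]) zero_le_one)
    linarith
  have hloss := mul_nonneg hD (show 0 ≤ (w - q) ^ 2 / 2 by positivity)
  by_cases h : w = 1 - b
  · have hDval : 1 - max (w - b) (max (2 * w - 1) 0) = 2 * b := by
      rw [h, max_eq_left (max_le (by linarith) (by linarith))]
      ring
    rw [hDval] at hloss ⊢
    subst h
    refine ⟨by nlinarith [hloss], fun heq => ⟨rfl, ?_⟩, fun hq => by rw [hq.2]; ring⟩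
    have hzero : b * (1 - b - q) ^ 2 = 0 := by linear_combination -heq
    have := pow_eq_zero_iff two_ne_zero |>.1
      ((mul_eq_zero.1 hzero).resolve_left (by linarith))
    linarith
  · have hlt := demand_mul_sq_lt hb1 hb2 hw.1 h
    have hlt' : (1 - max (w - b) (max (2 * w - 1) 0)) * (w * q - q ^ 2 / 2) <
        b * (1 - b) ^ 2 := by linarith
    exact ⟨hlt'.le, fun heq => absurd heq hlt'.ne, fun hq => absurd hq.1 h⟩
end

section
/- Fix b with 0 ≤ b ≤ 1/5. Define Π_b : [0,1] × [0,∞) → ℝ by Π_b(w, q) = (1 − max(w − b, 2w − 1, 0))·(w·q − q²/2). Then Π_b(w, q) ≤ 2(1+b)³/27 for all (w, q) ∈ [0,1] × [0,∞), with equality if and only if (w, q) = (2(1+b)/3, 2(1+b)/3). -/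
open Set

/-- Low-bias branch of the optimal single-item menu (Section 6.1): for `0 ≤ b ≤ 1/5`,
the profit `Π_b(w, q) = (1 − max(w − b, 2w − 1, 0))(wq − q²/2)` is at most
`2(1 + b)³/27` on `[0,1] × [0,∞)`, with equality iff `(w, q) = (2(1+b)/3, 2(1+b)/3)`. -/
theorem stmt9 (b : ℝ) (hb1 : 0 ≤ b) (hb2 : b ≤ 1 / 5) :
    ∀ w ∈ Icc (0:ℝ) 1, ∀ q : ℝ, 0 ≤ q →
      (1 - max (w - b) (max (2 * w - 1) 0)) * (w * q - q ^ 2 / 2)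
        ≤ 2 * (1 + b) ^ 3 / 27 ∧
      ((1 - max (w - b) (max (2 * w - 1) 0)) * (w * q - q ^ 2 / 2)
          = 2 * (1 + b) ^ 3 / 27 ↔
        w = 2 * (1 + b) / 3 ∧ q = 2 * (1 + b) / 3) := by
  intro w hw q _
  obtain ⟨hw0, hw1⟩ := hw
  set M := max (w - b) (max (2 * w - 1) 0) with hM
  have hM1 : M ≤ 1 := max_le (by linarith) (max_le (by linarith) zero_le_one)
  have hMw : w - b ≤ M := le_max_left _ _
  have gap : 2 * (1 + b) ^ 3 / 27 - (1 - M) * (w * q - q ^ 2 / 2)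
      = (1 - M) * (w - q) ^ 2 / 2 + (M - (w - b)) * w ^ 2 / 2
        + (w - 2 * (1 + b) / 3) ^ 2 * (w + (1 + b) / 3) / 2 := by ring
  have h1 : 0 ≤ (1 - M) * (w - q) ^ 2 / 2 :=
    div_nonneg (mul_nonneg (by linarith) (sq_nonneg _)) zero_le_two
  have h2 : 0 ≤ (M - (w - b)) * w ^ 2 / 2 :=
    div_nonneg (mul_nonneg (by linarith) (sq_nonneg _)) zero_le_two
  have h3 : 0 ≤ (w - 2 * (1 + b) / 3) ^ 2 * (w + (1 + b) / 3) / 2 := by positivity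
  refine ⟨by linarith, fun h => ?_, ?_⟩
  · have e1 : (1 - M) * (w - q) ^ 2 = 0 := by linarith
    have e3 : (w - 2 * (1 + b) / 3) ^ 2 * (w + (1 + b) / 3) = 0 := by linarith
    have hM_ne : 1 - M ≠ 0 := by
      intro h0
      rw [h0, zero_mul] at h
      have : 0 < 2 * (1 + b) ^ 3 / 27 := by positivity
      linarith
    have hw_eq : w = 2 * (1 + b) / 3 :=
      sub_eq_zero.mp (pow_eq_zero_iff two_ne_zero |>.mp
        ((mul_eq_zero.mp e3).resolve_right (by positivity)))
    have hq_eq : w = q :=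
      sub_eq_zero.mp (pow_eq_zero_iff two_ne_zero |>.mp
        ((mul_eq_zero.mp e1).resolve_left hM_ne))
    exact ⟨hw_eq, hq_eq ▸ hw_eq⟩
  · rintro ⟨hw_eq, hq_eq⟩
    have : M = w - b := max_eq_left (max_le (by linarith) (by linarith))
    rw [this, hw_eq, hq_eq]
    ring
end

section
/- Let N ≥ 1 be an integer and b > 0 with 1 − (1 + 4(N − 1))b ≥ 0. Set w_i = 1 − (1 + 2(N − i))b and q_i = 1 − (1 + 4(N − i))b for i = 1, ..., N, and define transfers by t_1 = w_1 q_1 and t_i = t_{i−1} + w_i (q_i − q_{i−1}) for i = 2, ..., N. Then this menu is incentive compatible and individually rational for the posterior types w_1, ..., w_N: for all i, j ∈ {1, ..., N}, w_i q_i − t_i ≥ w_i q_j − t_j, and w_i q_i − t_i ≥ 0 for all i. -/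
/-- Incentive compatibility and individual rationality of the optimal N-item menu in
the Uniform-Quadratic environment (Section 6): with posterior types
`w_i = 1 − (1 + 2(N − i))b`, qualities `q_i = 1 − (1 + 4(N − i))b`, and transfers built
from binding local downward incentive constraints, every posterior type `w_i` weakly
prefers its own item to every other item and earns nonnegative surplus. -/
theorem stmt13 (N : ℕ) (hN : 1 ≤ N) (b : ℝ) (hb : 0 < b)
    (hq1 : 0 ≤ 1 - (1 + 4 * ((N : ℝ) - 1)) * b)
    (w q t : ℕ → ℝ)
    (hw : ∀ i, 1 ≤ i → i ≤ N → w i = 1 - (1 + 2 * ((N : ℝ) - (i : ℝ))) * b)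
    (hq : ∀ i, 1 ≤ i → i ≤ N → q i = 1 - (1 + 4 * ((N : ℝ) - (i : ℝ))) * b)
    (ht1 : t 1 = w 1 * q 1)
    (ht : ∀ i, 2 ≤ i → i ≤ N → t i = t (i - 1) + w i * (q i - q (i - 1))) :
    (∀ i, 1 ≤ i → i ≤ N → ∀ j, 1 ≤ j → j ≤ N →
      w i * q j - t j ≤ w i * q i - t i) ∧
    (∀ i, 1 ≤ i → i ≤ N → 0 ≤ w i * q i - t i) := by
  have closed_form : ∀ i : ℕ, 1 ≤ i → i ≤ N →
      t i = w 1 * q 1 + 4 * b * (((i : ℝ) - 1) * w 1 + b * i * ((i : ℝ) - 1)) := by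
    intro i hi
    induction i, hi using Nat.le_induction with
    | base => intro _; rw [ht1]; push_cast; ring
    | succ k hk ih =>
      intro hkN
      rw [ht (k + 1) (by lia) hkN, Nat.add_sub_cancel, ih (by lia), hw (k + 1) (by lia) hkN,
        hq (k + 1) (by lia) hkN, hq k hk (by lia), hw 1 le_rfl hN]
      push_cast
      ring
  have int_sq (m : ℤ) : (0 : ℝ) ≤ (m : ℝ) ^ 2 - m := by
    have h : m ≤ m ^ 2 := Int.le_self_sq m
    have h' : (m : ℝ) ≤ (m : ℝ) ^ 2 := by exact_mod_cast h
    linarith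
  refine ⟨fun i hi hiN j hj hjN => ?_, fun i hi hiN => ?_⟩
  · have h := mul_nonneg (sq_nonneg (2 * b)) (int_sq ((i : ℤ) - j))
    push_cast at h
    rw [closed_form i hi hiN, closed_form j hj hjN, hw i hi hiN, hq i hi hiN, hq j hj hjN,
      hw 1 le_rfl hN, hq 1 le_rfl hN]
    push_cast
    linarith
  · have h := mul_nonneg (sq_nonneg (2 * b)) (int_sq ((i : ℤ) - 1))
    have hi' : (0 : ℝ) ≤ (i : ℝ) - 1 := by
      rw [sub_nonneg]
      exact_mod_cast hi
    have h' := mul_nonneg (mul_nonneg hb.le hi') hq1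
    push_cast at h
    rw [closed_form i hi hiN, hw i hi hiN, hq i hi hiN, hw 1 le_rfl hN, hq 1 le_rfl hN]
    push_cast
    linarith
end

section
/- Let ν be a Borel probability measure on [0,1] with CDF F(θ) = ν([0,θ]). Then the set of Borel probability measures μ on [0,1] whose CDF G(θ) = μ([0,θ]) satisfies ∫_0^θ (F(x) − G(x))dx ≥ 0 for every θ ∈ [0,1] and ∫_0^1 (F(x) − G(x))dx = 0 is a compact subset of the space of Borel probability measures on [0,1] endowed with the topology of weak convergence. -/
open MeasureTheory Set

/-- The truncated put payoff `y ↦ (θ - y⁺)⁺` as a bounded continuous function. -/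
noncomputable def putPayoff (θ : ℝ) : BoundedContinuousFunction ℝ ℝ :=
  BoundedContinuousFunction.ofNormedAddCommGroup (fun y => max 0 (θ - max y 0))
    (by fun_prop) |θ| (fun y => by
      have h := le_max_right y 0
      rw [Real.norm_of_nonneg (le_max_left _ _)]
      exact max_le (abs_nonneg _) ((sub_le_self _ h).trans (le_abs_self _)))

theorem putPayoff_apply (θ y : ℝ) : putPayoff θ y = max 0 (θ - max y 0) := rfl

/-- A bounded continuous function which is positive exactly outside of `[0,1]`. -/
noncomputable def escapeUnitInterval : BoundedContinuousFunction ℝ ℝ :=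
  BoundedContinuousFunction.ofNormedAddCommGroup (fun y => min 1 (max 0 (max (-y) (y - 1))))
    (by fun_prop) 1 (fun y => by
      rw [Real.norm_of_nonneg (le_min zero_le_one (le_max_left _ _))]
      exact min_le_left _ _)

theorem escapeUnitInterval_apply (y : ℝ) :
    escapeUnitInterval y = min 1 (max 0 (max (-y) (y - 1))) := rfl

theorem escapeUnitInterval_nonneg (y : ℝ) : 0 ≤ escapeUnitInterval y :=
  le_min zero_le_one (le_max_left _ _)

theorem escapeUnitInterval_eq_zero_iff (y : ℝ) :
    escapeUnitInterval y = 0 ↔ y ∈ Icc (0 : ℝ) 1 := by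
  rw [escapeUnitInterval_apply, mem_Icc]
  constructor
  · intro h
    rcases min_choice 1 (max 0 (max (-y) (y - 1))) with h1 | h1
    · rw [h1] at h
      exact absurd h one_ne_zero
    · have h2 : max 0 (max (-y) (y - 1)) ≤ 0 := (h1.symm.trans h).le
      simp only [max_le_iff] at h2
      exact ⟨by linarith, by linarith⟩
  · rintro ⟨h0, h1⟩
    rw [max_eq_left (max_le (by linarith) (by linarith)), min_eq_right zero_le_one]

theorem measure_compl_Icc_eq_zero_iff (μ : ProbabilityMeasure ℝ) :
    μ.toMeasure (Icc (0 : ℝ) 1)ᶜ = 0 ↔ ∫ y, escapeUnitInterval y ∂μ.toMeasure = 0 := by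
  rw [integral_eq_zero_iff_of_nonneg escapeUnitInterval_nonneg
    (escapeUnitInterval.integrable _), Filter.EventuallyEq, ae_iff]
  simp only [Pi.zero_apply, escapeUnitInterval_eq_zero_iff]
  rfl

theorem measureReal_Icc_eq_integral (μ : Measure ℝ) (x : ℝ) :
    (μ (Icc (0 : ℝ) x)).toReal = ∫ y, (Icc (0 : ℝ) x).indicator (fun _ => (1 : ℝ)) y ∂μ := by
  rw [integral_indicator_const _ measurableSet_Icc]
  simp [Measure.real]

theorem integral_indicator_Icc_eq_putPayoff {θ y : ℝ} (hθ : 0 ≤ θ) (hy : 0 ≤ y) :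
    ∫ x in (0 : ℝ)..θ, (Icc (0 : ℝ) x).indicator (fun _ => (1 : ℝ)) y = putPayoff θ y := by
  have h : ∀ x, (Icc (0 : ℝ) x).indicator (fun _ => (1 : ℝ)) y
      = (Ici y).indicator (fun _ => (1 : ℝ)) x := fun x => by
    simp [indicator_apply, hy]
  simp_rw [h]
  rw [intervalIntegral.integral_of_le hθ, integral_indicator_const _ measurableSet_Ici,
    putPayoff_apply, max_eq_left hy, smul_eq_mul, mul_one,
    measureReal_restrict_apply measurableSet_Ici]
  have hae : (Ici y ∩ Ioc 0 θ : Set ℝ) =ᵐ[volume] (Ioi y ∩ Ioc 0 θ : Set ℝ) :=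
    Ioi_ae_eq_Ici.symm.inter (Filter.EventuallyEq.refl _ _)
  rw [measureReal_congr hae, inter_comm, Ioc_inter_Ioi, max_eq_right hy, Measure.real,
    Real.volume_Ioc, ENNReal.toReal_ofReal', max_comm]

theorem measurableSet_nonneg_le : MeasurableSet {p : ℝ × ℝ | p.2 ∈ Icc (0 : ℝ) p.1} :=
  (measurableSet_le measurable_const measurable_snd).inter
    (measurableSet_le measurable_snd measurable_fst)

theorem monotone_measureReal_Icc (μ : Measure ℝ) [IsFiniteMeasure μ] :
    Monotone fun x => (μ (Icc (0 : ℝ) x)).toReal := fun _ _ h =>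
  measureReal_mono (Icc_subset_Icc_right h)

/-- The integrated CDF of a measure on the nonnegative half-line is the mean put payoff. -/
theorem integral_cdf_eq_integral_putPayoff (μ : Measure ℝ) [IsFiniteMeasure μ]
    (hμ : ∀ᵐ y ∂μ, 0 ≤ y) {θ : ℝ} (hθ : 0 ≤ θ) :
    ∫ x in (0 : ℝ)..θ, (μ (Icc (0 : ℝ) x)).toReal = ∫ y, putPayoff θ y ∂μ := by
  simp_rw [measureReal_Icc_eq_integral μ]
  rw [intervalIntegral.integral_of_le hθ, integral_integral_swap]
  · refine integral_congr_ae (hμ.mono fun y hy => ?_)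
    simp only
    rw [← intervalIntegral.integral_of_le hθ, integral_indicator_Icc_eq_putPayoff hθ hy]
  · exact (integrable_const (1 : ℝ)).indicator measurableSet_nonneg_le

theorem integral_sub_cdf (μ ν : Measure ℝ) [IsFiniteMeasure μ] [IsFiniteMeasure ν]
    (hμ : μ (Icc (0 : ℝ) 1)ᶜ = 0) (hν : ν (Icc (0 : ℝ) 1)ᶜ = 0) {θ : ℝ} (hθ : 0 ≤ θ) :
    ∫ x in (0 : ℝ)..θ, ((ν (Icc (0 : ℝ) x)).toReal - (μ (Icc (0 : ℝ) x)).toReal)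
      = ∫ y, putPayoff θ y ∂ν - ∫ y, putPayoff θ y ∂μ := by
  have hnn : ∀ ρ : Measure ℝ, ρ (Icc (0 : ℝ) 1)ᶜ = 0 → ∀ᵐ y ∂ρ, 0 ≤ y := fun ρ hρ =>
    Filter.mem_of_superset (mem_ae_iff.2 hρ) fun _ hy => hy.1
  rw [intervalIntegral.integral_sub (monotone_measureReal_Icc ν).intervalIntegrable
    (monotone_measureReal_Icc μ).intervalIntegrable,
    integral_cdf_eq_integral_putPayoff ν (hnn ν hν) hθ,
    integral_cdf_eq_integral_putPayoff μ (hnn μ hμ) hθ]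

/-- A closed set of probability measures carried by a compact set is compact. -/
theorem isCompact_of_isClosed_of_measure_compl_eq_zero {S : Set (ProbabilityMeasure ℝ)}
    {K : Set ℝ} (hK : IsCompact K) (hS : IsClosed S)
    (h : ∀ μ ∈ S, μ.toMeasure Kᶜ = 0) : IsCompact S := by
  rw [← hS.closure_eq]
  refine isCompact_closure_of_isTightMeasureSet ?_
  rw [isTightMeasureSet_iff_exists_isCompact_measure_compl_le]
  refine fun ε _ => ⟨K, hK, ?_⟩
  rintro _ ⟨μ, hμ, rfl⟩
  exact (h μ hμ).le.trans zero_le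

/-- Compactness of the set of mean-preserving contractions (key ingredient of
Proposition 1): the set of Borel probability measures on `[0,1]` whose CDF `G` satisfies
`∫_0^θ (F − G) ≥ 0` for all `θ ∈ [0,1]`, with equality at `θ = 1`, is compact in the
topology of weak convergence. -/
theorem stmt14 (ν : ProbabilityMeasure ℝ)
    (hν : ν.toMeasure (Icc (0:ℝ) 1)ᶜ = 0)
    (F : ℝ → ℝ) (hF : ∀ θ, F θ = (ν.toMeasure (Icc (0:ℝ) θ)).toReal) :
    IsCompact {μ : ProbabilityMeasure ℝ |
      μ.toMeasure (Icc (0:ℝ) 1)ᶜ = 0 ∧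
      (∀ θ ∈ Icc (0:ℝ) 1,
        0 ≤ ∫ x in (0:ℝ)..θ, (F x - (μ.toMeasure (Icc (0:ℝ) x)).toReal)) ∧
      (∫ x in (0:ℝ)..1, (F x - (μ.toMeasure (Icc (0:ℝ) x)).toReal)) = 0} := by
  refine isCompact_of_isClosed_of_measure_compl_eq_zero isCompact_Icc ?_ fun μ hμ => hμ.1
  have hcont (f : BoundedContinuousFunction ℝ ℝ) :
      Continuous fun μ : ProbabilityMeasure ℝ => ∫ y, f y ∂μ.toMeasure :=
    ProbabilityMeasure.continuous_integral_boundedContinuousFunction f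
  have hset : {μ : ProbabilityMeasure ℝ |
      μ.toMeasure (Icc (0:ℝ) 1)ᶜ = 0 ∧
      (∀ θ ∈ Icc (0:ℝ) 1,
        0 ≤ ∫ x in (0:ℝ)..θ, (F x - (μ.toMeasure (Icc (0:ℝ) x)).toReal)) ∧
      (∫ x in (0:ℝ)..1, (F x - (μ.toMeasure (Icc (0:ℝ) x)).toReal)) = 0}
      = {μ | ∫ y, escapeUnitInterval y ∂μ.toMeasure = 0} ∩
        ((⋂ θ ∈ Icc (0:ℝ) 1, {μ | 0 ≤
          ∫ y, putPayoff θ y ∂ν.toMeasure - ∫ y, putPayoff θ y ∂μ.toMeasure}) ∩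
        {μ | ∫ y, putPayoff 1 y ∂ν.toMeasure - ∫ y, putPayoff 1 y ∂μ.toMeasure = 0}) := by
    ext μ
    simp only [mem_ofPred_eq, mem_inter_iff, mem_iInter, ← measure_compl_Icc_eq_zero_iff, hF]
    refine and_congr_right fun hμ => and_congr (forall₂_congr fun θ hθ => ?_) ?_
    · rw [integral_sub_cdf _ _ hμ hν hθ.1]
    · rw [integral_sub_cdf _ _ hμ hν zero_le_one]
  rw [hset]
  exact (isClosed_eq (hcont _) continuous_const).inter
    ((isClosed_biInter fun θ _ =>
      isClosed_le continuous_const (continuous_const.sub (hcont _))).inter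
      (isClosed_eq (continuous_const.sub (hcont _)) continuous_const))
end
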